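/- Let M ≥ 3, u ∈ ℝ³ and u_th > 0, and let f : ℝ³ → ℝ be a finite Hermite expansion f(v) = Σ_{|α| ≤ M} f_α 𝓗_{u_th,α}(ξ) with ξ = (v − u)/√u_th, where u and u_th coincide with the macroscopic velocity and thermal velocity of f and the density of f is positive. Then the heat flux satisfies q_i = 2 f_{3e_i} + Σ_{d=1}^{3} f_{2e_d + e_i} for i = 1,2,3, where q_i = (1/2) ∫_{ℝ³} |v−u|² (v_i − u_i) f(v) dv. -/

import Mathlib

open MeasureTheory Real

/-- Probabilists' Hermite polynomial `He_n(x) = (-1)^n e^{x²/2} dⁿ/dxⁿ e^{-x²/2}`,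
extended by `0` for negative indices. -/
noncomputable def He (n : ℤ) (x : ℝ) : ℝ :=
  if n < 0 then 0
  else (-1 : ℝ) ^ n.toNat * Real.exp (x ^ 2 / 2) *
    iteratedDeriv n.toNat (fun y => Real.exp (-(y ^ 2) / 2)) x

/-- Hermite basis function `𝓗_{uth,α}(ξ)`; it vanishes whenever a component of
the multi-index `α` is negative. -/
noncomputable def hermiteH (uth : ℝ) (α : Fin 3 → ℤ) (ξ : Fin 3 → ℝ) : ℝ :=
  ∏ d : Fin 3, (Real.sqrt (2 * π))⁻¹ * uth ^ ((-(α d : ℝ) - 1) / 2) *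
    He (α d) (ξ d) * Real.exp (-(ξ d) ^ 2 / 2)

/-- The set of multi-indices `α ∈ ℕ³` with `|α| ≤ M`. -/
def multiIndices (M : ℕ) : Finset (Fin 3 → ℕ) :=
  (Finset.Icc 0 fun _ => M).filter fun α => ∑ d, α d ≤ M

open Polynomial in
theorem He_natCast (n : ℕ) (x : ℝ) : He n x = ((hermite n).map (Int.castRingHom ℝ)).eval x := by
  have h := hermite_eq_deriv_gaussian' n x
  rw [aeval_def, algebraMap_int_eq] at h
  rw [He, if_neg (by simp), Int.toNat_natCast, iteratedDeriv_eq_iterate, eval_map, h]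
  simp only [neg_div]
  ring

open Polynomial in
theorem integrable_polynomial_mul_gaussian (P : ℝ[X]) :
    Integrable fun x : ℝ => P.eval x * exp (-x ^ 2 / 2) := by
  induction P using Polynomial.induction_on' with
  | add p q hp hq => simpa only [eval_add, add_mul] using! hp.add hq
  | monomial n a =>
    have h := (integrable_rpow_mul_exp_neg_mul_sq (b := 1 / 2) (by norm_num)
      (s := n) (by linarith [n.cast_nonneg (α := ℝ)])).const_mul a
    refine h.congr (ae_of_all _ fun x => ?_)
    simp only [eval_monomial, rpow_natCast, mul_assoc]
    ring_nf

open Polynomial in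
/-- Gaussian integration by parts (Stein's identity) for polynomials. -/
theorem integral_derivative_mul_gaussian (P : ℝ[X]) :
    ∫ x : ℝ, (derivative P).eval x * exp (-x ^ 2 / 2) =
      ∫ x : ℝ, (X * P).eval x * exp (-x ^ 2 / 2) := by
  rw [← sub_eq_zero, ← integral_sub (integrable_polynomial_mul_gaussian _)
    (integrable_polynomial_mul_gaussian _)]
  refine integral_eq_zero_of_hasDerivAt_of_integrable (fun x => ?_)
    ((integrable_polynomial_mul_gaussian _).sub (integrable_polynomial_mul_gaussian _))
    (integrable_polynomial_mul_gaussian P)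
  have hg : HasDerivAt (fun x : ℝ => -x ^ 2 / 2) (-x) x := by
    convert! ((hasDerivAt_pow 2 x).neg.div_const 2) using 1
    push_cast
    ring
  convert! (P.hasDerivAt x).mul hg.exp using 1
  simp only [eval_mul, eval_X]
  ring

/-- The value of `(2π)^{-1/2} ∫ y^k He_n(y) e^{-y²/2} dy`. -/
def hermiteMoment : ℕ → ℕ → ℝ
  | 0, 0 => 1
  | 0, _ + 1 => 0
  | k + 1, 0 => hermiteMoment k 1
  | k + 1, n + 1 => (k + 1) * hermiteMoment k n

theorem le_and_even_of_hermiteMoment_ne_zero {k n : ℕ} (h : hermiteMoment k n ≠ 0) :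
    n ≤ k ∧ Even (k + n) := by
  induction k generalizing n with
  | zero => cases n <;> simp_all [hermiteMoment]
  | succ k ih =>
    cases n with
    | zero => exact ⟨Nat.zero_le _, by simpa using (ih h).2⟩
    | succ n =>
      obtain ⟨h1, h2⟩ := ih (right_ne_zero_of_mul h)
      exact ⟨by lia, by grind⟩

theorem integrable_pow_mul_He (k n : ℕ) :
    Integrable fun y : ℝ => y ^ k * He n y * exp (-y ^ 2 / 2) := by
  refine (integrable_polynomial_mul_gaussian
    (Polynomial.X ^ k * (Polynomial.hermite n).map (Int.castRingHom ℝ))).congr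
      (ae_of_all _ fun y => ?_)
  simp [He_natCast]

open Polynomial in
theorem integral_pow_mul_He (k n : ℕ) :
    ∫ y : ℝ, y ^ k * He n y * exp (-y ^ 2 / 2) = √(2 * π) * hermiteMoment k n := by
  have key (P : ℝ[X]) (n : ℕ) :
      ∫ y : ℝ, (P * (hermite (n + 1)).map (Int.castRingHom ℝ)).eval y * exp (-y ^ 2 / 2) =
      ∫ y : ℝ, (derivative P * (hermite n).map (Int.castRingHom ℝ)).eval y *
        exp (-y ^ 2 / 2) := by
    have h := integral_derivative_mul_gaussian (P * (hermite n).map (Int.castRingHom ℝ))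
    rw [← sub_eq_zero, ← integral_sub (integrable_polynomial_mul_gaussian _)
      (integrable_polynomial_mul_gaussian _)] at h ⊢
    rw [← neg_eq_zero, ← integral_neg, ← h]
    congr 1
    ext y
    simp only [hermite_succ, derivative_mul, Polynomial.map_sub, Polynomial.map_mul, map_X,
      eval_mul, eval_add, eval_sub, eval_X, derivative_map]
    ring
  have hHe (k n : ℕ) (y : ℝ) : y ^ k * He n y =
      (X ^ k * (hermite n).map (Int.castRingHom ℝ)).eval y := by
    simp [He_natCast]
  simp only [hHe]
  induction k generalizing n with
  | zero =>
    cases n with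
    | zero =>
      have h := integral_gaussian (1 / 2)
      rw [show π / (1 / 2) = 2 * π by ring] at h
      simp only [hermiteMoment, hermite_zero, pow_zero, mul_one, map_one, Polynomial.map_one,
        eval_one, one_mul]
      rw [← h]
      congr 1
      ext y
      ring_nf
    | succ n => rw [key]; simp [hermiteMoment]
  | succ k ih =>
    cases n with
    | zero =>
      rw [hermiteMoment, ← ih]
      simp [pow_succ]
    | succ n =>
      rw [key, hermiteMoment, mul_left_comm, ← ih, ← integral_const_mul]
      congr 1
      ext y
      simp
      ring

section OneDimensional

variable {θ : ℝ} (a : ℝ) (k n : ℕ)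

theorem pow_sub_mul_hermite_factor (hθ : 0 < θ) (x : ℝ) :
    (x - a) ^ k * ((√(2 * π))⁻¹ * θ ^ ((-((n : ℤ) : ℝ) - 1) / 2) *
      He n ((x - a) / √θ) * exp (-((x - a) / √θ) ^ 2 / 2)) =
    (√(2 * π))⁻¹ * (√θ ^ k * (√θ ^ (n + 1))⁻¹) * (((x - a) / √θ) ^ k *
      He n ((x - a) / √θ) * exp (-((x - a) / √θ) ^ 2 / 2)) := by
  have h0 : √θ ≠ 0 := (sqrt_pos.2 hθ).ne'
  have hp : θ ^ ((-((n : ℤ) : ℝ) - 1) / 2) = (√θ ^ (n + 1))⁻¹ := by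
    rw [sqrt_eq_rpow, ← rpow_natCast, ← rpow_mul hθ.le, ← rpow_neg hθ.le]
    congr 1
    push_cast
    ring
  rw [hp, div_pow _ _ k]
  field_simp

theorem integrable_pow_sub_mul_hermite_factor (hθ : 0 < θ) :
    Integrable fun x : ℝ => (x - a) ^ k * ((√(2 * π))⁻¹ * θ ^ ((-((n : ℤ) : ℝ) - 1) / 2) *
      He n ((x - a) / √θ) * exp (-((x - a) / √θ) ^ 2 / 2)) := by
  simp only [pow_sub_mul_hermite_factor a k n hθ]
  exact (((integrable_pow_mul_He k n).comp_div (sqrt_pos.2 hθ).ne').comp_sub_right a).const_mul _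

theorem integral_pow_sub_mul_hermite_factor (hθ : 0 < θ) :
    ∫ x : ℝ, (x - a) ^ k * ((√(2 * π))⁻¹ * θ ^ ((-((n : ℤ) : ℝ) - 1) / 2) *
      He n ((x - a) / √θ) * exp (-((x - a) / √θ) ^ 2 / 2)) =
    √θ ^ k * (√θ ^ n)⁻¹ * hermiteMoment k n := by
  simp only [pow_sub_mul_hermite_factor a k n hθ]
  have h0 : 0 < √θ := sqrt_pos.2 hθ
  have h1 : 0 < √(2 * π) := sqrt_pos.2 (by positivity)
  rw [integral_const_mul, integral_sub_right_eq_self (fun x : ℝ => (x / √θ) ^ k *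
    He n (x / √θ) * exp (-(x / √θ) ^ 2 / 2)),
    Measure.integral_comp_div (fun y : ℝ => y ^ k * He n y * exp (-y ^ 2 / 2)),
    integral_pow_mul_He, abs_of_pos h0, smul_eq_mul]
  field_simp
  ring

end OneDimensional

section ThreeDimensional

variable {θ : ℝ} (u : Fin 3 → ℝ) (a α : Fin 3 → ℕ)

theorem integrable_monomial_mul_hermiteH (hθ : 0 < θ) :
    Integrable fun v : Fin 3 → ℝ => (∏ j, (v j - u j) ^ a j) *
      hermiteH θ (fun d => (α d : ℤ)) (fun d => (v d - u d) / √θ) := by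
  simp only [hermiteH, ← Finset.prod_mul_distrib]
  exact Integrable.fintype_prod fun d =>
    integrable_pow_sub_mul_hermite_factor (u d) (a d) (α d) hθ

theorem integral_monomial_mul_hermiteH (hθ : 0 < θ) :
    ∫ v : Fin 3 → ℝ, (∏ j, (v j - u j) ^ a j) *
      hermiteH θ (fun d => (α d : ℤ)) (fun d => (v d - u d) / √θ) =
    ∏ d, √θ ^ a d * (√θ ^ α d)⁻¹ * hermiteMoment (a d) (α d) := by
  have h := integral_fintype_prod_volume_eq_prod fun d (x : ℝ) => (x - u d) ^ a d *
    ((√(2 * π))⁻¹ * θ ^ ((-((α d : ℤ) : ℝ) - 1) / 2) *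
      He (α d) ((x - u d) / √θ) * exp (-((x - u d) / √θ) ^ 2 / 2))
  simp only [fun d => integral_pow_sub_mul_hermite_factor (u d) (a d) (α d) hθ] at h
  rw [← h]
  simp only [hermiteH, ← Finset.prod_mul_distrib]

variable {M : ℕ} {c : (Fin 3 → ℕ) → ℝ} {f : (Fin 3 → ℝ) → ℝ}

theorem integrable_monomial_mul_expansion (hθ : 0 < θ)
    (hf : ∀ v, f v = ∑ α ∈ multiIndices M, c α *
      hermiteH θ (fun d => (α d : ℤ)) (fun d => (v d - u d) / √θ)) :
    Integrable fun v : Fin 3 → ℝ => (∏ j, (v j - u j) ^ a j) * f v := by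
  simp only [hf, Finset.mul_sum, mul_left_comm _ (c _)]
  exact integrable_finsetSum _ fun α _ => (integrable_monomial_mul_hermiteH u a α hθ).const_mul _

theorem integral_monomial_mul_expansion (hθ : 0 < θ)
    (hf : ∀ v, f v = ∑ α ∈ multiIndices M, c α *
      hermiteH θ (fun d => (α d : ℤ)) (fun d => (v d - u d) / √θ)) :
    ∫ v : Fin 3 → ℝ, (∏ j, (v j - u j) ^ a j) * f v =
      ∑ α ∈ multiIndices M, c α * ∏ d, √θ ^ a d * (√θ ^ α d)⁻¹ * hermiteMoment (a d) (α d) := by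
  simp only [hf, Finset.mul_sum, mul_left_comm _ (c _)]
  rw [integral_finsetSum _ fun α _ => (integrable_monomial_mul_hermiteH u a α hθ).const_mul _]
  simp only [integral_const_mul, integral_monomial_mul_hermiteH u _ _ hθ]

theorem mem_multiIndices {α : Fin 3 → ℕ} : α ∈ multiIndices M ↔ ∑ d, α d ≤ M := by
  simp only [multiIndices, Finset.mem_filter, Finset.mem_Icc, and_iff_right_iff_imp]
  refine fun h => ⟨fun _ => Nat.zero_le _, fun d => ?_⟩
  exact (Finset.single_le_sum (fun _ _ => Nat.zero_le _) (Finset.mem_univ d)).trans h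

theorem integral_unit_monomial_mul_expansion (hθ : 0 < θ) (hM : 1 ≤ M)
    (hf : ∀ v, f v = ∑ α ∈ multiIndices M, c α *
      hermiteH θ (fun d => (α d : ℤ)) (fun d => (v d - u d) / √θ)) (i : Fin 3) :
    ∫ v : Fin 3 → ℝ, (∏ j, (v j - u j) ^ (if j = i then 1 else 0)) * f v =
      c fun j => if j = i then 1 else 0 := by
  have h0 : √θ ≠ 0 := (sqrt_pos.2 hθ).ne'
  rw [integral_monomial_mul_expansion u (fun j => if j = i then 1 else 0) hθ hf,
    Finset.sum_eq_single_of_mem (fun j => if j = i then 1 else 0)]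
  · fin_cases i <;> simp [Fin.prod_univ_three, hermiteMoment, h0]
  · simpa [mem_multiIndices] using hM
  · intro α _ hα
    by_contra! h
    refine hα (funext fun j => ?_)
    have hj := le_and_even_of_hermiteMoment_ne_zero <| right_ne_zero_of_mul <|
      Finset.prod_ne_zero_iff.1 (right_ne_zero_of_mul h) j (Finset.mem_univ j)
    grind

theorem integral_cubic_monomial_mul_expansion (hθ : 0 < θ) (hM : 3 ≤ M)
    (hf : ∀ v, f v = ∑ α ∈ multiIndices M, c α *
      hermiteH θ (fun d => (α d : ℤ)) (fun d => (v d - u d) / √θ)) (d i : Fin 3) :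
    ∫ v : Fin 3 → ℝ, (∏ j, (v j - u j) ^ ((if j = d then 2 else 0) + (if j = i then 1 else 0))) *
        f v =
      (if d = i then 3 else 1) * θ * (c fun j => if j = i then 1 else 0) +
      (if d = i then 6 else 2) *
        c fun j => (if j = d then 2 else 0) + (if j = i then 1 else 0) := by
  have h0 : √θ ≠ 0 := (sqrt_pos.2 hθ).ne'
  have h2 : √θ ^ 2 = θ := sq_sqrt hθ.le
  rw [integral_monomial_mul_expansion u
      (fun j => (if j = d then 2 else 0) + (if j = i then 1 else 0)) hθ hf,
    ← Finset.sum_subset (s₁ := {fun j => if j = i then 1 else 0,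
      fun j => (if j = d then 2 else 0) + (if j = i then 1 else 0)}), Finset.sum_pair]
  · congr 1
    · rw [mul_comm]
      congr 1
      fin_cases i <;> fin_cases d <;> simp [Fin.prod_univ_three, hermiteMoment, h0] <;>
        field_simp <;> grind
    · rw [mul_comm]
      congr 1
      fin_cases i <;> fin_cases d <;> simp [Fin.prod_univ_three, hermiteMoment, h0] <;> norm_num
  · intro h
    simpa using congrFun h d
  · intro α hα
    simp only [Finset.mem_insert, Finset.mem_singleton] at hα
    rw [mem_multiIndices]
    rcases hα with rfl | rfl
    · simp
      lia
    · simp [Finset.sum_add_distrib]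
      lia
  · intro α _ hα
    by_contra! h
    have hj (j : Fin 3) := le_and_even_of_hermiteMoment_ne_zero <| right_ne_zero_of_mul <|
      Finset.prod_ne_zero_iff.1 (right_ne_zero_of_mul h) j (Finset.mem_univ j)
    simp only [Finset.mem_insert, Finset.mem_singleton, not_or] at hα
    have hd := hj d
    by_cases hlow : α d ≤ 1
    · refine hα.1 (funext fun j => ?_)
      have := hj j
      by_cases hjd : j = d
      · subst hjd
        grind
      · grind
    · refine hα.2 (funext fun j => ?_)
      have := hj j
      by_cases hjd : j = d
      · subst hjd
        grind
      · grind

end ThreeDimensional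

/-- The heat flux of a finite Hermite expansion (centered at its own
macroscopic velocity and thermal velocity) in terms of the coefficients:
`q_i = 2 f_{3e_i} + ∑_d f_{2e_d + e_i}`. -/
theorem heat_flux_of_hermite_expansion
    (M : ℕ) (hM : 3 ≤ M)
    (u : Fin 3 → ℝ) (uth : ℝ) (huth : 0 < uth)
    (c : (Fin 3 → ℕ) → ℝ) (f : (Fin 3 → ℝ) → ℝ)
    -- `f` is the finite Hermite expansion with coefficients `c α = f_α`
    (hf : ∀ v, f v = ∑ α ∈ multiIndices M, c α *
      hermiteH uth (fun d => (α d : ℤ)) (fun d => (v d - u d) / Real.sqrt uth))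
    (ρ : ℝ) (hρpos : 0 < ρ)
    -- `ρ, u, uth` are the density, macroscopic velocity and thermal velocity of `f`
    (hρ : ρ = ∫ v, f v)
    (hu : ∀ d, ρ * u d = ∫ v, v d * f v)
    (huth : ρ * (∑ d, u d ^ 2) + 3 * ρ * uth = ∫ v, (∑ d, v d ^ 2) * f v)
    -- the heat flux
    (q : Fin 3 → ℝ)
    (hq : ∀ i, q i = (1 / 2) * ∫ v, (∑ d, (v d - u d) ^ 2) * (v i - u i) * f v) :
    ∀ i : Fin 3, q i =
      2 * c (fun j => if j = i then 3 else 0) +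
        ∑ d : Fin 3, c fun j =>
          (if j = d then 2 else 0) + (if j = i then 1 else 0) := by
  have hθ : 0 < uth := by assumption
  have hfint : Integrable f := by
    simpa using integrable_monomial_mul_expansion u (fun _ => 0) hθ hf
  have hc (i : Fin 3) : c (fun j => if j = i then 1 else 0) = 0 := by
    rw [← integral_unit_monomial_mul_expansion u hθ (by lia) hf i]
    have hint := integrable_monomial_mul_expansion u (fun j => if j = i then 1 else 0) hθ hf
    simp only [pow_ite, pow_one, pow_zero, Finset.prod_ite_eq',
      Finset.mem_univ, if_true] at hint ⊢
    have hvint : Integrable fun v : Fin 3 → ℝ => v i * f v := by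
      refine (hint.add (hfint.const_mul (u i))).congr (ae_of_all _ fun v => ?_)
      simp only [Pi.add_apply]
      ring
    simp only [sub_mul]
    rw [integral_sub hvint (hfint.const_mul _), integral_const_mul, ← hu, ← hρ]
    ring
  intro i
  have hexp (v : Fin 3 → ℝ) : (∑ d, (v d - u d) ^ 2) * (v i - u i) * f v =
      ∑ d, (∏ j, (v j - u j) ^ ((if j = d then 2 else 0) + (if j = i then 1 else 0))) * f v := by
    simp only [pow_add, Finset.prod_mul_distrib, pow_ite, pow_one, pow_zero, Finset.prod_ite_eq',
      Finset.mem_univ, if_true, Finset.sum_mul]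
  rw [hq]
  simp only [hexp]
  rw [integral_finsetSum _ fun d _ => integrable_monomial_mul_expansion u
    (fun j => (if j = d then 2 else 0) + (if j = i then 1 else 0)) hθ hf]
  simp only [integral_cubic_monomial_mul_expansion u hθ hM hf, hc, mul_zero, zero_add]
  have hdiag : (fun j => if j = i then 3 else 0) =
      fun j : Fin 3 => (if j = i then 2 else 0) + (if j = i then 1 else 0) := by
    funext j
    split_ifs <;> rfl
  have hcoef (d : Fin 3) : (if d = i then (6 : ℝ) else 2) = (if d = i then 4 else 0) + 2 := by
    split_ifs <;> norm_num
  simp only [hcoef, add_mul, ite_mul, zero_mul, Finset.sum_add_distrib, Finset.sum_ite_eq',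
    Finset.mem_univ, if_true, ← Finset.mul_sum]
  rw [hdiag]
  ring
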